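/- arXiv:0806.0281 — 3 statements merged into one kernel-verified Lean document; each statement's English description precedes it below -/
import Mathlib

section
/- Let n, s, k be integers with 1 ≤ s ≤ n and 1 ≤ k ≤ s−1. Then p_{n;≤s;k} = Σ_{i=1}^{s−k} C(n, n−s+i+k) · p_{s−i−k, s−i−1; ≤ s−i−1} · p_{n−s+i+k; ≤ i}, where C(a,b) is the binomial coefficient. -/
/-- One parking step: a car with preference `a` parks in the first unoccupied
space `j` with `a ≤ j ≤ m`, if such a space exists; otherwise it leaves. -/
def parkStep (m : ℕ) (occ : Finset ℕ) (a : ℕ) : Finset ℕ :=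
  if h : ((Finset.Icc a m) \ occ).Nonempty then
    insert (((Finset.Icc a m) \ occ).min' h) occ
  else occ

/-- The set of occupied spaces after the cars with preference list `l`
(in order of arrival) have tried to park among spaces `1, …, m`. -/
def occupied (m : ℕ) (l : List ℕ) : Finset ℕ := l.foldl (parkStep m) ∅

/-- The number of cars that leave unparked. -/
def flaws (m : ℕ) (l : List ℕ) : ℕ := l.length - (occupied m l).card

/-- The preference list (with entries in `[1, s]`) encoded by a function `Fin n → Fin s`. -/
def prefList {n s : ℕ} (f : Fin n → Fin s) : List ℕ :=
  (List.ofFn f).map (fun i => (i : ℕ) + 1)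

/-- `p n m s k` is the number of `k`-flaw preference sets of length `n` with `m`
parking spaces, all of whose entries are at most `s`. -/
def p (n m s k : ℕ) : ℕ :=
  (Finset.univ.filter (fun f : Fin n → Fin s => flaws m (prefList f) = k)).card

/-- `pL n m s k l` is the number of `k`-flaw preference sets of length `n` with `m`
parking spaces, entries at most `s`, and first entry `l`. -/
def pL (n m s k l : ℕ) : ℕ :=
  (Finset.univ.filter (fun f : Fin n → Fin s =>
    flaws m (prefList f) = k ∧ (prefList f).head? = some l)).card

/-- The set of empty spaces. -/
def empties (m : ℕ) (l : List ℕ) : Finset ℕ := Finset.Icc 1 m \ occupied m l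

/-- `n_α`: the number of entries equal to the first entry. -/
def nstat (l : List ℕ) : ℕ := l.count l.headI

/-- `h_α`: the number of empty spaces smaller than the first entry. -/
def hstat (m : ℕ) (l : List ℕ) : ℕ := ((empties m l).filter (fun x => x < l.headI)).card

/-- `τ_α`: the number of entries smaller than the first entry, plus one. -/
def taustat (l : List ℕ) : ℕ := l.countP (fun a => a < l.headI) + 1

/-- `m_α`: the largest empty space. -/
def mstat (m : ℕ) (l : List ℕ) : ℕ := (empties m l).sup id

open Finset

lemma parkStep_cases (m : ℕ) (occ : Finset ℕ) (a : ℕ) :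
    (parkStep m occ a = occ ∧ ∀ x, a ≤ x → x ≤ m → x ∈ occ) ∨
    ∃ b, a ≤ b ∧ b ≤ m ∧ b ∉ occ ∧ (∀ x, a ≤ x → x < b → x ∈ occ) ∧
      parkStep m occ a = insert b occ := by
  unfold parkStep
  split_ifs with h
  · right
    have hm := Finset.min'_mem _ h
    have hl : ∀ x ∈ Finset.Icc a m \ occ, (Finset.Icc a m \ occ).min' h ≤ x :=
      fun x hx => Finset.min'_le _ x hx
    generalize (Finset.Icc a m \ occ).min' h = b at hm hl ⊢
    simp only [mem_sdiff, mem_Icc] at hm hl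
    refine ⟨b, hm.1.1, hm.1.2, hm.2, ?_, rfl⟩
    intro x h1 h2
    by_contra h3
    have := hl x ⟨⟨h1, by omega⟩, h3⟩
    omega
  · left
    refine ⟨rfl, fun x h1 h2 => ?_⟩
    by_contra h3
    exact h ⟨x, by simp [h1, h2, h3]⟩

lemma occupied_snoc (m : ℕ) (l : List ℕ) (a : ℕ) :
    occupied m (l ++ [a]) = parkStep m (occupied m l) a := by
  simp [occupied]

lemma occupied_facts (m : ℕ) (l : List ℕ) (hl : ∀ a ∈ l, 1 ≤ a) :
    occupied m l ⊆ Icc 1 m ∧ (occupied m l).card ≤ l.length ∧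
    (∀ d, ((occupied m l).filter (· ≤ d)).card ≤ l.countP (· ≤ d)) ∧
    (∀ e, e ≤ m → e ∉ occupied m l →
      ((occupied m l).filter (· ≤ e)).card = l.countP (· ≤ e)) := by
  induction l using List.reverseRecOn with
  | nil => simp [occupied]
  | append_singleton l a ih =>
    obtain ⟨h1, h2, h3, h4⟩ := ih (fun x hx => hl x (by simp [hx]))
    have ha : 1 ≤ a := hl a (by simp)
    rw [occupied_snoc]
    rcases parkStep_cases m (occupied m l) a with ⟨h, hf⟩ | ⟨b, hb1, hb2, hb3, hb4, h⟩
    · rw [h]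
      refine ⟨h1, by simp; omega, fun d => ?_, fun e he heo => ?_⟩
      · have := h3 d
        simp only [List.countP_append]
        omega
      · have := h4 e he heo
        have hae : ¬ a ≤ e := fun hh => heo (hf e hh he)
        simp [List.countP_append, this, List.countP_cons, hae]
    · rw [h]
      refine ⟨?_, ?_, fun d => ?_, fun e he heo => ?_⟩
      · intro x hx
        rcases Finset.mem_insert.1 hx with rfl | hx
        · simp; omega
        · exact h1 hx
      · rw [card_insert_of_notMem hb3]; simp; omega
      · have h5 := h3 d
        rw [filter_insert]
        simp only [List.countP_append, List.countP_cons, List.countP_nil, decide_eq_true_eq]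
        by_cases q : b ≤ d
        · have had : a ≤ d := by omega
          rw [if_pos q, if_pos had, card_insert_of_notMem (by simp [hb3])]
          omega
        · rw [if_neg q]
          omega
      · simp only [mem_insert, not_or] at heo
        have h5 := h4 e he heo.2
        rw [filter_insert]
        simp only [List.countP_append, List.countP_cons, List.countP_nil, decide_eq_true_eq]
        by_cases q : b ≤ e
        · have hae : a ≤ e := by omega
          rw [if_pos q, if_pos hae, card_insert_of_notMem (by simp [hb3])]
          omega
        · have hae : ¬ a ≤ e := by
            intro hh
            exact heo.2 (hb4 e hh (by omega))
          rw [if_neg q, if_neg hae]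
          omega

lemma flaws_iff (m k : ℕ) (l : List ℕ) (hl : ∀ a ∈ l, 1 ≤ a) :
    flaws m l = k ↔ (∀ d ≤ m, l.countP (d < ·) + d ≤ m + k) ∧
      ∃ d ≤ m, l.countP (d < ·) + d = m + k := by
  obtain ⟨h1, h2, h3, h4⟩ := occupied_facts m l hl
  have hc : ∀ d, l.countP (d < ·) + l.countP (· ≤ d) = l.length := by
    intro d
    have := List.length_eq_countP_add_countP (l := l) (fun a => decide (d < a))
    simp only [decide_eq_true_eq, not_lt] at this
    omega
  have hs : ∀ d, ((occupied m l).filter (· ≤ d)).card + ((occupied m l).filter (d < ·)).card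
      = (occupied m l).card := by
    intro d
    have := card_filter_add_card_filter_not (s := occupied m l) (fun x => x ≤ d)
    simpa only [not_le] using this
  have hsub : ∀ d, (occupied m l).filter (d < ·) ⊆ Ioc d m := by
    intro d x hx
    simp only [mem_filter] at hx
    have := mem_Icc.1 (h1 hx.1)
    simp; omega
  have up : ∀ d ≤ m, l.countP (d < ·) + d ≤ m + flaws m l := by
    intro d hd
    have a1 := card_le_card (hsub d)
    rw [Nat.card_Ioc] at a1
    have := hc d; have := hs d; have := h3 d
    unfold flaws
    omega
  have ex : ∃ d ≤ m, l.countP (d < ·) + d = m + flaws m l := by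
    have h0 : 0 ∉ occupied m l := fun h => by simpa using h1 h
    have hne : ((range (m+1)).filter (· ∉ occupied m l)).Nonempty := ⟨0, by simp [h0]⟩
    obtain ⟨e, he, hmax⟩ := exists_max_image _ id hne
    simp only [mem_filter, mem_range, id] at he hmax
    refine ⟨e, by omega, ?_⟩
    have hEq : (occupied m l).filter (e < ·) = Ioc e m := by
      apply Subset.antisymm (hsub e)
      intro x hx
      simp only [mem_Ioc] at hx
      simp only [mem_filter]
      refine ⟨?_, hx.1⟩
      by_contra hh
      have := hmax x ⟨by omega, hh⟩
      omega
    have a1 := congrArg card hEq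
    rw [Nat.card_Ioc] at a1
    have := hc e; have := hs e; have := h4 e (by omega) he.2
    unfold flaws
    omega
  constructor
  · rintro rfl; exact ⟨up, ex⟩
  · rintro ⟨u, d, hd, hx⟩
    obtain ⟨d', hd', hx'⟩ := ex
    have := up d hd
    have := u d' hd'
    omega

/-- number of coordinates with value at least `d` -/
def cntGe {ι : Type*} [Fintype ι] (f : ι → ℕ) (d : ℕ) : ℕ :=
  (univ.filter (fun i => d ≤ f i)).card

lemma prefList_eq {n s : ℕ} (f : Fin n → Fin s) :
    prefList f = (List.finRange n).map (fun i => (f i : ℕ) + 1) := by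
  unfold prefList
  rw [List.ofFn_eq_map]
  simp only [List.bind_eq_flatMap, List.pure_def]
  induction List.finRange n with
  | nil => rfl
  | cons a t ih => simpa using ih

lemma countP_prefList {n s : ℕ} (f : Fin n → Fin s) (d : ℕ) :
    (prefList f).countP (d < ·) = cntGe (fun i => (f i : ℕ)) d := by
  rw [prefList_eq]
  unfold cntGe
  rw [List.countP_map, List.countP_eq_length_filter,
    ← List.toFinset_card_of_nodup ((List.nodup_finRange n).filter _)]
  congr 1
  ext i
  simp [Nat.lt_succ_iff]

lemma p_eq (n m s k : ℕ) : p n m s k =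
    ((Fintype.piFinset (fun _ : Fin n => range s)).filter (fun f =>
      (∀ d ≤ m, cntGe f d + d ≤ m + k) ∧ ∃ d ≤ m, cntGe f d + d = m + k)).card := by
  unfold p
  refine card_bij (fun f _ => fun i => (f i : ℕ)) ?_ ?_ ?_
  · intro f hf
    simp only [mem_filter, mem_univ, true_and, Fintype.mem_piFinset, mem_range] at hf ⊢
    rw [flaws_iff _ _ _ (by simp [prefList_eq])] at hf
    simp only [countP_prefList] at hf
    exact ⟨fun i => (f i).2, hf⟩
  · intro f _ g _ h
    funext i
    exact Fin.ext (congrFun h i)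
  · intro f hf
    simp only [mem_filter, Fintype.mem_piFinset, mem_range] at hf
    refine ⟨fun i => ⟨f i, hf.1 i⟩, ?_, rfl⟩
    simp only [mem_filter, mem_univ, true_and]
    rw [flaws_iff _ _ _ (by simp [prefList_eq])]
    simp only [countP_prefList]
    exact hf.2

/-- parking functions on an arbitrary finite index type -/
def pfSet (ι : Type*) [Fintype ι] [DecidableEq ι] (m s : ℕ) : Finset (ι → ℕ) :=
  (Fintype.piFinset (fun _ : ι => range s)).filter (fun f => ∀ d ≤ m, cntGe f d + d ≤ m)

lemma cntGe_zero_of_lt {ι : Type*} [Fintype ι] (f : ι → ℕ) (s d : ℕ) (h : ∀ i, f i < s)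
    (hd : s ≤ d) : cntGe f d = 0 := by
  unfold cntGe
  rw [card_eq_zero, filter_eq_empty_iff]
  intro i _
  have := h i
  omega

lemma p_zero_eq (ι : Type*) [Fintype ι] [DecidableEq ι] (n m s : ℕ) (hsm : s ≤ m)
    (hn : Fintype.card ι = n) : p n m s 0 = (pfSet ι m s).card := by
  rw [p_eq]
  have e := Fintype.equivFinOfCardEq hn
  have key : ∀ (f : Fin n → ℕ) d, cntGe (fun i => f (e i)) d = cntGe f d := by
    intro f d
    unfold cntGe
    refine card_bij (fun i _ => e i) (by simp) (by simp) ?_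
    intro b hb
    exact ⟨e.symm b, by simpa using hb, by simp⟩
  refine card_bij (fun f _ => fun i => f (e i)) ?_ ?_ ?_
  · intro f hf
    simp only [mem_filter, Fintype.mem_piFinset, mem_range, pfSet, key] at hf ⊢
    exact ⟨fun i => hf.1 _, hf.2.1⟩
  · intro f _ g _ h
    funext i
    simpa using congrFun h (e.symm i)
  · intro g hg
    simp only [mem_filter, Fintype.mem_piFinset, mem_range, pfSet] at hg
    refine ⟨fun i => g (e.symm i), ?_, by simp⟩
    have hk : ∀ d, cntGe (fun i => g (e.symm i)) d = cntGe g d := by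
      intro d
      rw [← key]; simp
    simp only [mem_filter, Fintype.mem_piFinset, mem_range, hk]
    refine ⟨fun i => hg.1 _, hg.2, m, le_rfl, ?_⟩
    rw [cntGe_zero_of_lt g s m hg.1 hsm]; omega

/-- the block of the decomposition with smallest maximiser `e` and big coordinates `S` -/
def blk (n s k e : ℕ) (S : Finset (Fin n)) : Finset (Fin n → ℕ) :=
  (Fintype.piFinset (fun _ : Fin n => range s)).filter (fun f =>
    (∀ i, i ∈ S ↔ e ≤ f i) ∧ (∀ d < e, cntGe f d + d < n + k) ∧
      ∀ d, e ≤ d → d ≤ n → cntGe f d + d ≤ n + k)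

lemma cntGe_split {n : ℕ} (S : Finset (Fin n)) (f : Fin n → ℕ) (d : ℕ) :
    cntGe f d = cntGe (fun x : {x // x ∈ S} => f x) d +
      cntGe (fun x : {x // x ∉ S} => f x) d := by
  unfold cntGe
  rw [← card_filter_add_card_filter_not (s := univ.filter (fun i => d ≤ f i)) (fun x => x ∈ S)]
  congr 1
  · symm
    refine card_bij (fun i _ => i.1) (by simp) (fun a _ b _ h => Subtype.ext h) ?_
    intro b hb
    simp only [mem_filter, mem_univ, true_and] at hb
    exact ⟨⟨b, hb.2⟩, by simpa using hb.1, rfl⟩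
  · symm
    refine card_bij (fun i _ => i.1) (fun a ha => by simpa using ⟨by simpa using ha, a.2⟩) (fun a _ b _ h => Subtype.ext h) ?_
    intro b hb
    simp only [mem_filter, mem_univ, true_and] at hb
    exact ⟨⟨b, hb.2⟩, by simpa using hb.1, rfl⟩

lemma cntGe_all {ι : Type*} [Fintype ι] (f : ι → ℕ) (d : ℕ) (h : ∀ i, d ≤ f i) :
    cntGe f d = Fintype.card ι := by
  unfold cntGe
  rw [filter_true_of_mem (fun i _ => h i), card_univ]

lemma cntGe_pos {ι : Type*} [Fintype ι] (f : ι → ℕ) (d : ℕ) (i : ι) (h : d ≤ f i) :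
    0 < cntGe f d := card_pos.2 ⟨i, by simpa using h⟩

lemma cntGe_sub {ι : Type*} [Fintype ι] (f : ι → ℕ) (e d : ℕ) (h : ∀ i, e ≤ f i) :
    cntGe (fun i => f i - e) d = cntGe f (d + e) := by
  unfold cntGe
  congr 1
  ext i
  have := h i
  simp; omega

lemma blk_card (n s k e : ℕ) (hsn : s ≤ n) (hk : 1 ≤ k) (hke : k ≤ e) (hes : e < s)
    (S : Finset (Fin n)) (hS : S.card = n + k - e) :
    (blk n s k e S).card = (pfSet {x // x ∉ S} (e-1) (e-1)).card *
      (pfSet {x // x ∈ S} (n+k-e) (s-e)).card := by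
  have hcS : Fintype.card {x // x ∈ S} = n + k - e := by simp [hS]
  rw [← card_product]
  refine card_bij' (fun f _ => (fun x => f x, fun x => f x - e))
    (fun g _ => fun x => if hx : x ∈ S then g.2 ⟨x, hx⟩ + e else g.1 ⟨x, hx⟩) ?_ ?_ ?_ ?_
  · intro f hf
    simp only [blk, pfSet, mem_filter, Fintype.mem_piFinset, mem_range, mem_product] at hf ⊢
    obtain ⟨h1, h2, h3, h4⟩ := hf
    have hlow : ∀ d < e, cntGe (fun x : {x // x ∉ S} => f x) d + d ≤ e - 1 := by
      intro d hd
      have := h3 d hd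
      rw [cntGe_split S, cntGe_all (fun x : {x // x ∈ S} => f x) d
        (fun x => hd.le.trans ((h2 x).1 x.2)), hcS] at this
      omega
    refine ⟨⟨fun x => ?_, fun d hd => hlow d (by omega)⟩, fun x => ?_, fun d hd => ?_⟩
    · by_contra hh
      have := cntGe_pos (fun x : {x // x ∉ S} => f x) (e-1) x (by omega)
      have := hlow (e-1) (by omega)
      omega
    · have := h1 x; omega
    · rw [cntGe_sub (fun x : {x // x ∈ S} => f x) e d (fun x => (h2 x).1 x.2)]
      by_cases hd' : d + e ≤ n
      · have := h4 (d+e) (by omega) hd'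
        rw [cntGe_split S] at this
        omega
      · rw [cntGe_zero_of_lt (fun x : {x // x ∈ S} => f x) s _ (fun x => h1 x) (by omega)]
        omega
  · rintro ⟨g, h⟩ hg
    simp only [blk, pfSet, mem_filter, Fintype.mem_piFinset, mem_range, mem_product] at hg ⊢
    obtain ⟨⟨g1, g2⟩, h1, h2⟩ := hg
    have sp : ∀ d, cntGe (fun x => if hx : x ∈ S then h ⟨x, hx⟩ + e else g ⟨x, hx⟩) d =
        cntGe (fun x => h x + e) d + cntGe g d := by
      intro d
      rw [cntGe_split S]
      congr 2
      · funext x; simp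
      · funext x; simp [x.2]
    refine ⟨fun x => ?_, fun x => ?_, fun d hd => ?_, fun d hd hdn => ?_⟩
    · split_ifs with hx
      · have := h1 ⟨x, hx⟩; omega
      · have := g1 ⟨x, hx⟩; omega
    · split_ifs with hx
      · simp [hx]
      · have := g1 ⟨x, hx⟩
        simp [hx]; omega
    · rw [sp, cntGe_all (fun x => h x + e) d (fun x => by omega), hcS]
      have := g2 d (by omega)
      omega
    · rw [sp, cntGe_zero_of_lt g (e-1) d g1 (by omega)]
      have := h2 (d-e) (by omega)
      have q := cntGe_sub (fun x => h x + e) e (d-e) (fun x => by omega)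
      simp only [Nat.add_sub_cancel, Nat.sub_add_cancel hd] at q
      change cntGe h (d-e) = _ at q
      omega
  · intro f hf
    simp only [blk, mem_filter] at hf
    funext x
    by_cases hx : x ∈ S
    · have := (hf.2.1 x).1 hx
      simp [hx, this]
    · simp [hx]
  · rintro ⟨g, h⟩ hg
    refine Prod.ext ?_ ?_
    · funext x; simp [x.2]
    · funext x; simp

lemma main_sum (n s k : ℕ) (hsn : s ≤ n) (hk1 : 1 ≤ k) :
    p n n s k = ∑ e ∈ Ico k s, ∑ S ∈ powersetCard (n + k - e) (univ : Finset (Fin n)),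
      (blk n s k e S).card := by
  have hblk : ∀ e S f, S.card = n + k - e → e < s → f ∈ blk n s k e S →
      cntGe f e + e = n + k ∧ (∀ d < e, cntGe f d + d < n + k) := by
    intro e S f hS he hf
    simp only [blk, mem_filter] at hf
    refine ⟨?_, hf.2.2.1⟩
    have : S = univ.filter (fun i => e ≤ f i) := by
      ext i; simp [hf.2.1 i]
    unfold cntGe
    rw [← this]; omega
  rw [p_eq]
  have : ∀ e ∈ Ico k s, ∑ S ∈ powersetCard (n + k - e) (univ : Finset (Fin n)),
      (blk n s k e S).card =
      ((powersetCard (n + k - e) (univ : Finset (Fin n))).biUnion (blk n s k e)).card := by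
    intro e he
    rw [card_biUnion]
    intro S _ T _ hST
    rw [Function.onFun, disjoint_left]
    intro f hf hg
    simp only [blk, mem_filter] at hf hg
    apply hST
    ext i
    rw [hf.2.1, hg.2.1]
  rw [sum_congr rfl this, ← card_biUnion]
  · congr 1
    ext f
    simp only [mem_biUnion, mem_filter]
    constructor
    · rintro ⟨h1, h2, h3⟩
      have hlt : ∀ i, f i < s := by simpa using h1
      classical
      obtain ⟨hen, he⟩ := Nat.find_spec h3
      have hmin := fun d => Nat.find_min h3 (m := d)
      generalize Nat.find h3 = e at hen he hmin
      have hle : cntGe f e ≤ n := by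
        unfold cntGe
        exact (card_le_univ _).trans (by simp)
      refine ⟨e, ?_, univ.filter (fun i => e ≤ f i), ?_, ?_⟩
      · rw [mem_Ico]
        refine ⟨by omega, ?_⟩
        by_contra hh
        rw [cntGe_zero_of_lt f s e hlt (by omega)] at he
        omega
      · rw [mem_powersetCard]
        refine ⟨subset_univ _, ?_⟩
        unfold cntGe at he
        omega
      · simp only [blk, mem_filter]
        refine ⟨h1, by simp, fun d hd => ?_, fun d _ hd => h2 d hd⟩
        have a := h2 d (by omega)
        have b := hmin d hd
        have : cntGe f d + d ≠ n + k := fun h => b ⟨by omega, h⟩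
        omega
    · rintro ⟨e, he, S, hS, hf⟩
      rw [mem_Ico] at he
      rw [mem_powersetCard] at hS
      have := hblk e S f hS.2 he.2 hf
      simp only [blk, mem_filter] at hf
      refine ⟨hf.1, fun d hd => ?_, e, by omega, this.1⟩
      rcases lt_or_ge d e with h | h
      · exact (this.2 d h).le
      · exact hf.2.2.2 d h hd
  · intro e he e' he' hne
    rw [Function.onFun, disjoint_left]
    intro f hf hg
    simp only [mem_biUnion, mem_powersetCard] at hf hg
    obtain ⟨S, hS, hf⟩ := hf
    obtain ⟨T, hT, hg⟩ := hg
    have a := hblk e S f hS.2 (mem_Ico.1 he).2 hf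
    have b := hblk e' T f hT.2 (mem_Ico.1 he').2 hg
    rcases lt_trichotomy e e' with h | h | h
    · have := b.2 e h; omega
    · exact hne h
    · have := a.2 e' h; omega

/-- Lemma 2.1: for `1 ≤ s ≤ n` and `1 ≤ k ≤ s - 1`,
`p_{n;≤s;k} = Σ_{i=1}^{s-k} C(n, n-s+i+k) · p_{s-i-k,s-i-1;≤s-i-1} · p_{n-s+i+k;≤i}`. -/
theorem stmt0 (n s k : ℕ) (hs1 : 1 ≤ s) (hsn : s ≤ n) (hk1 : 1 ≤ k) (hks : k ≤ s - 1) :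
    p n n s k =
      ∑ i ∈ Finset.Icc 1 (s - k),
        Nat.choose n (n - s + i + k) * p (s - i - k) (s - i - 1) (s - i - 1) 0 *
          p (n - s + i + k) (n - s + i + k) i 0 := by
  rw [main_sum n s k hsn hk1]
  refine sum_bij' (fun e _ => s - e) (fun i _ => s - i) ?_ ?_ ?_ ?_ ?_
  · intro e he; simp only [mem_Ico, mem_Icc] at he ⊢; omega
  · intro e he; simp only [mem_Ico, mem_Icc] at he ⊢; omega
  · intro e he; simp only [mem_Ico] at he; omega
  · intro e he; simp only [mem_Icc] at he; omega
  · intro e he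
    rw [mem_Ico] at he
    have e1 : n - s + (s - e) + k = n + k - e := by omega
    have e2 : s - (s - e) - k = e - k := by omega
    have e3 : s - (s - e) - 1 = e - 1 := by omega
    rw [e1, e2, e3]
    have : ∀ S ∈ powersetCard (n + k - e) (univ : Finset (Fin n)), (blk n s k e S).card =
        p (e - k) (e - 1) (e - 1) 0 * p (n + k - e) (n + k - e) (s - e) 0 := by
      intro S hS
      have hS := (mem_powersetCard.1 hS).2
      rw [blk_card n s k e hsn hk1 he.1 he.2 S hS,
        p_zero_eq {x // x ∉ S} (e - k) (e - 1) (e - 1) le_rfl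
          (by rw [Fintype.card_subtype_compl]; simp [hS]; omega),
        p_zero_eq {x // x ∈ S} (n + k - e) (n + k - e) (s - e) (by omega) (by simp [hS])]
    rw [sum_congr rfl this, sum_const, card_powersetCard]
    simp [mul_assoc]
end

section
/- For all integers k ≥ 0 and n ≥ 1, the number of parking functions of length n with n+k spaces and first entry 1 equals the number of parking functions of length n−1 with n+k spaces: p^1_{n,n+k;≤n+k} = p_{n−1,n+k;≤n+k}. -/
theorem mem_parkStep (m : ℕ) (S : Finset ℕ) (a x : ℕ) :
    x ∈ parkStep m S a ↔ x ∈ S ∨ (a ≤ x ∧ x ≤ m ∧ ∀ y, a ≤ y → y < x → y ∈ S) := by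
  unfold parkStep
  split_ifs with h
  · have h1 := Finset.min'_mem _ h
    have h2 : ∀ y ∈ Finset.Icc a m \ S, (Finset.Icc a m \ S).min' h ≤ y :=
      fun y hy => Finset.min'_le _ y hy
    generalize (Finset.Icc a m \ S).min' h = e at *
    simp only [Finset.mem_sdiff, Finset.mem_Icc, Finset.mem_insert] at *
    constructor
    · rintro (rfl | hx)
      · right
        refine ⟨h1.1.1, h1.1.2, fun y hy hyx => ?_⟩
        by_contra hc
        have := h2 y ⟨⟨hy, by omega⟩, hc⟩
        omega
      · exact Or.inl hx
    · rintro (hx | ⟨h3, h4, h5⟩)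
      · exact Or.inr hx
      · by_cases hx : x ∈ S
        · exact Or.inr hx
        · left
          have := h2 x ⟨⟨h3, h4⟩, hx⟩
          by_contra hne
          exact h1.2 (h5 e h1.1.1 (by omega))
  · constructor
    · exact Or.inl
    · rintro (hx | ⟨h3, h4, h5⟩)
      · exact hx
      · by_contra hx
        exact h ⟨x, by simp [h3, h4, hx]⟩

theorem parkStep_comm_le (m : ℕ) (S : Finset ℕ) (a b : ℕ) :
    parkStep m (parkStep m S a) b ⊆ parkStep m (parkStep m S b) a := by
  intro x hx
  simp only [mem_parkStep] at *
  rcases hx with (hx | ⟨h1, h2, h3⟩) | ⟨h1, h2, h3⟩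
  · exact Or.inl (Or.inl hx)
  · exact Or.inr ⟨h1, h2, fun y hy hyx => Or.inl (h3 y hy hyx)⟩
  · by_cases hall : ∀ y, b ≤ y → y < x → y ∈ S
    · exact Or.inl (Or.inr ⟨h1, h2, hall⟩)
    · push Not at hall
      obtain ⟨y0, hb, hyx, hy0⟩ := hall
      obtain ⟨g1, g2, g3⟩ := (h3 y0 hb hyx).resolve_left hy0
      refine Or.inr ⟨by omega, h2, fun y hy hy' => ?_⟩
      rcases lt_trichotomy y y0 with h | h | h
      · exact Or.inl (g3 y hy h)
      · subst h
        refine Or.inr ⟨hb, g2, fun z hz hz' => ?_⟩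
        rcases h3 z hz (by omega) with h | h
        · exact h
        · exact g3 z h.1 hz'
      · rcases h3 y (by omega) hy' with h' | h'
        · exact Or.inl h'
        · exact absurd (h'.2.2 y0 g1 h) hy0

theorem parkStep_comm (m : ℕ) (S : Finset ℕ) (a b : ℕ) :
    parkStep m (parkStep m S a) b = parkStep m (parkStep m S b) a :=
  Finset.Subset.antisymm (parkStep_comm_le m S a b) (parkStep_comm_le m S b a)

theorem foldl_parkStep_comm (m : ℕ) (l : List ℕ) (S : Finset ℕ) (a : ℕ) :
    l.foldl (parkStep m) (parkStep m S a) = parkStep m (l.foldl (parkStep m) S) a := by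
  induction l generalizing S with
  | nil => rfl
  | cons b l ih => simp only [List.foldl_cons]; rw [parkStep_comm, ih]

theorem card_foldl_le (m : ℕ) (l : List ℕ) (S : Finset ℕ) :
    (l.foldl (parkStep m) S).card ≤ S.card + l.length := by
  induction l generalizing S with
  | nil => simp
  | cons b l ih =>
    simp only [List.foldl_cons, List.length_cons]
    have h1 := ih (parkStep m S b)
    have h2 : (parkStep m S b).card ≤ S.card + 1 := by
      unfold parkStep
      split_ifs
      · exact Finset.card_insert_le _ _
      · omega
    omega

theorem flaws_one_cons (m : ℕ) (l : List ℕ) (hl : l.length + 1 ≤ m) :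
    flaws m (1 :: l) = flaws m l := by
  have h1 : occupied m (1 :: l) = parkStep m (occupied m l) 1 := by
    simp only [occupied, List.foldl_cons]
    exact foldl_parkStep_comm m l ∅ 1
  have h2 : (occupied m l).card ≤ l.length := by
    simpa [occupied] using card_foldl_le m l ∅
  have h3 : (Finset.Icc 1 m \ occupied m l).Nonempty := by
    rw [← Finset.card_pos]
    have := Finset.le_card_sdiff (occupied m l) (Finset.Icc 1 m)
    simp only [Nat.card_Icc] at this
    omega
  have h4 : (parkStep m (occupied m l) 1).card = (occupied m l).card + 1 := by
    unfold parkStep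
    rw [dif_pos h3, Finset.card_insert_of_notMem]
    exact (Finset.mem_sdiff.1 (Finset.min'_mem _ h3)).2
  unfold flaws
  rw [h1, h4, List.length_cons]
  omega

/-- Theorem 4.2(1): `p^1_{n,n+k;≤n+k} = p_{n-1,n+k;≤n+k}` for `k ≥ 0`, `n ≥ 1`. -/
theorem stmt2 (n k : ℕ) (hn : 1 ≤ n) :
    pL n (n + k) (n + k) 0 1 = p (n - 1) (n + k) (n + k) 0 := by
  obtain ⟨N, rfl⟩ : ∃ N, n = N + 1 := ⟨n - 1, by omega⟩
  simp only [Nat.add_sub_cancel]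
  unfold pL p
  have hm : 0 < N + 1 + k := by omega
  generalize hM : N + 1 + k = M at *
  have key : ∀ g : Fin N → Fin M, flaws M (1 :: prefList g) = flaws M (prefList g) :=
    fun g => flaws_one_cons _ _ (by
      unfold prefList
      simp only [List.length_map, List.bind_eq_flatMap, List.pure_def,
        ← List.map_eq_flatMap, List.length_ofFn]
      omega)
  have hc : ∀ (c : Fin M) (g : Fin N → Fin M),
      prefList (Fin.cons c g : Fin (N + 1) → Fin M) = ((c : ℕ) + 1) :: prefList g := by
    intro c g
    simp [prefList, List.ofFn_succ]
  symm
  refine Finset.card_bij (fun g _ => (Fin.cons ⟨0, hm⟩ g : Fin (N + 1) → Fin M)) ?_ ?_ ?_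
  · intro g hg
    simp only [Finset.mem_filter, Finset.mem_univ, true_and] at hg ⊢
    rw [hc]
    simp [key, hg]
  · intro g _ g' _ h
    exact Fin.cons_right_injective _ h
  · intro f hf
    simp only [Finset.mem_filter, Finset.mem_univ, true_and] at hf
    obtain ⟨c, g, rfl⟩ : ∃ c g, f = Fin.cons c g := ⟨f 0, Fin.tail f, (Fin.cons_self_tail f).symm⟩
    rw [hc] at hf
    obtain ⟨h1, h2⟩ := hf
    simp only [List.head?_cons, Option.some.injEq] at h2
    have hc0 : c = ⟨0, hm⟩ := Fin.ext (by simpa using h2)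
    refine ⟨g, ?_, by rw [hc0]⟩
    rw [h2, key] at h1
    simpa using h1
end

section
/- For all integers k ≥ 0 and n ≥ 1, the number of parking functions of length n with n+k spaces and first entry n+k equals the number of parking functions of length n−1 with n+k−1 spaces: p^{n+k}_{n,n+k;≤n+k} = p_{n−1,n+k−1;≤n+k−1}. -/
theorem parkStep_insert_last (M : ℕ) (occ : Finset ℕ) (a : ℕ) :
    parkStep (M + 1) (insert (M + 1) occ) a = insert (M + 1) (parkStep M occ a) := by
  have h : Finset.Icc a (M + 1) \ insert (M + 1) occ = Finset.Icc a M \ occ := by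
    ext x
    simp only [Finset.mem_sdiff, Finset.mem_Icc, Finset.mem_insert, not_or]
    constructor
    · rintro ⟨⟨h1, h2⟩, h3, h4⟩
      exact ⟨⟨h1, by omega⟩, h4⟩
    · rintro ⟨⟨h1, h2⟩, h4⟩
      exact ⟨⟨h1, by omega⟩, by omega, h4⟩
  unfold parkStep
  simp only [h]
  split_ifs with h1
  · exact Finset.insert_comm _ _ _
  · rfl

theorem foldl_insert_last (M : ℕ) (l : List ℕ) : ∀ occ : Finset ℕ,
    l.foldl (parkStep (M + 1)) (insert (M + 1) occ)
      = insert (M + 1) (l.foldl (parkStep M) occ) := by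
  induction l with
  | nil => intro occ; rfl
  | cons a l ih =>
    intro occ
    rw [List.foldl_cons, List.foldl_cons, parkStep_insert_last, ih]

theorem foldl_le (M : ℕ) (l : List ℕ) : ∀ occ : Finset ℕ, (∀ x ∈ occ, x ≤ M) →
    ∀ x ∈ l.foldl (parkStep M) occ, x ≤ M := by
  induction l with
  | nil => intro occ h; exact h
  | cons a l ih =>
    intro occ h
    rw [List.foldl_cons]
    apply ih
    intro x hx
    unfold parkStep at hx
    split_ifs at hx with h1
    · rcases Finset.mem_insert.1 hx with h2 | h2
      · have := Finset.min'_mem _ h1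
        rw [← h2, Finset.mem_sdiff, Finset.mem_Icc] at this
        exact this.1.2
      · exact h x h2
    · exact h x hx

theorem foldl_card_le (M : ℕ) (l : List ℕ) : ∀ occ : Finset ℕ,
    (l.foldl (parkStep M) occ).card ≤ occ.card + l.countP (fun a => a ≤ M) := by
  induction l with
  | nil => intro occ; simp
  | cons a l ih =>
    intro occ
    rw [List.foldl_cons, List.countP_cons]
    refine (ih _).trans ?_
    have : (parkStep M occ a).card ≤ occ.card + if a ≤ M then 1 else 0 := by
      unfold parkStep
      split_ifs with h1 h2 h2
      · exact Finset.card_insert_le _ _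
      · obtain ⟨x, hx⟩ := h1
        rw [Finset.mem_sdiff, Finset.mem_Icc] at hx
        omega
      · omega
      · omega
    simp only [decide_eq_true_eq]
    omega

theorem flaws_cons_last (M : ℕ) (l : List ℕ) :
    flaws (M + 1) ((M + 1) :: l) = flaws M l := by
  have h0 : parkStep (M + 1) ∅ (M + 1) = insert (M + 1) ∅ := by
    simp [parkStep]
  have h1 : occupied (M + 1) ((M + 1) :: l) = insert (M + 1) (occupied M l) := by
    unfold occupied
    rw [List.foldl_cons, h0, foldl_insert_last]
  have h2 : M + 1 ∉ occupied M l := fun h => by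
    have := foldl_le M l ∅ (by simp) _ h
    omega
  unfold flaws
  rw [h1, Finset.card_insert_of_notMem h2, List.length_cons]
  omega

theorem le_of_flaws_zero (M : ℕ) (l : List ℕ) (h : flaws M l = 0) : ∀ a ∈ l, a ≤ M := by
  have h1 := foldl_card_le M l ∅
  have h2 : l.countP (fun a => a ≤ M) ≤ l.length := List.countP_le_length
  unfold flaws occupied at h
  rw [Finset.card_empty] at h1
  have h3 : l.countP (fun a => a ≤ M) = l.length := by omega
  rw [List.countP_eq_length] at h3
  intro a ha
  simpa using h3 a ha

theorem prefList_eq_ofFn {n s : ℕ} (f : Fin n → Fin s) :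
    prefList f = List.ofFn (fun i => (f i : ℕ) + 1) := by
  unfold prefList
  apply List.ext_getElem <;> simp [← List.map_eq_flatMap]

theorem prefList_succ {n s : ℕ} (f : Fin (n + 1) → Fin s) :
    prefList f = ((f 0 : ℕ) + 1) :: prefList (fun i => f i.succ) := by
  simp [prefList, List.ofFn_succ]

theorem prefList_castSucc {n s : ℕ} (g : Fin n → Fin s) :
    prefList (fun i => (g i).castSucc) = prefList g := by
  simp only [prefList_eq_ofFn, Fin.val_castSucc]

theorem pL_last (n M : ℕ) : pL (n + 1) (M + 1) (M + 1) 0 (M + 1) = p n M M 0 := by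
  unfold pL p
  symm
  refine Finset.card_bij
    (fun g _ => (Fin.cons (Fin.last M) (fun i => (g i).castSucc) : Fin (n + 1) → Fin (M + 1)))
    ?_ ?_ ?_
  · intro g hg
    simp only [Finset.mem_filter, Finset.mem_univ, true_and] at hg ⊢
    rw [prefList_succ]
    simp only [Fin.cons_zero, Fin.cons_succ, Fin.val_last, prefList_castSucc, flaws_cons_last]
    exact ⟨hg, rfl⟩
  · intro g _ g' _ h
    funext i
    have := congrFun h i.succ
    simpa using this
  · intro f hf
    simp only [Finset.mem_filter, Finset.mem_univ, true_and] at hf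
    rw [prefList_succ] at hf
    obtain ⟨h1, h2⟩ := hf
    have h3 : (f 0 : ℕ) + 1 = M + 1 := by simpa using h2
    rw [h3, flaws_cons_last] at h1
    have h4 : ∀ i : Fin n, (f i.succ : ℕ) < M := by
      intro i
      have := le_of_flaws_zero M _ h1 ((f i.succ : ℕ) + 1) (by
        rw [prefList_eq_ofFn, List.mem_ofFn]
        exact ⟨i, rfl⟩)
      omega
    refine ⟨fun i => ⟨f i.succ, h4 i⟩, ?_, ?_⟩
    · simp only [Finset.mem_filter, Finset.mem_univ, true_and]
      rw [← prefList_castSucc]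
      exact h1
    · funext i
      refine Fin.cases ?_ (fun j => ?_) i
      · apply Fin.ext
        simp only [Fin.cons_zero, Fin.val_last]
        omega
      · simp

/-- Lemma 4.1: `p^{n+k}_{n,n+k;≤n+k} = p_{n-1,n+k-1;≤n+k-1}` for `k ≥ 0`, `n ≥ 1`. -/
theorem stmt5 (n k : ℕ) (hn : 1 ≤ n) :
    pL n (n + k) (n + k) 0 (n + k) = p (n - 1) (n + k - 1) (n + k - 1) 0 := by
  obtain ⟨n, rfl⟩ : ∃ n0, n = n0 + 1 := ⟨n - 1, by omega⟩
  have h : n + 1 + k = (n + k) + 1 := by omega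
  rw [h, Nat.add_sub_cancel, Nat.add_sub_cancel]
  exact pL_last n (n + k)
end
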